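/- arXiv:1910.13178 — 3 statements merged into one kernel-verified Lean document; each statement's English description precedes it below -/
import Mathlib

section
/- Suppose a target is hidden according to the uniform distribution u on [0,L] and the Searcher starts at the root t ∈ [0,L]. Then: (i) u is strongly simply searchable from t — the two depth-first searches (unit speed from t to L then to 0, and from t to 0 then to L) are optimal, and every optimal search coincides with one of them until the interval is covered — and the optimal expected search time is V(t) = L − (t² + (L−t)²)/(2L); (ii) V(t) ≥ L/2 for all t ∈ [0,L], with equality if and only if t = 0 or t = L, so the optimal choice of starting point is a leaf node (an endpoint of the interval). -/
open MeasureTheory Set Filter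
open scoped ENNReal

noncomputable section

/-- A search of the interval network `Q = [-l₂, l₁]` with root `0`:
a 1-Lipschitz function on `[0,∞)` taking values in `Q` and starting at the root. -/
def IsSearch (l₁ l₂ : ℝ) (S : ℝ → ℝ) : Prop :=
  S 0 = 0 ∧ (∀ t, 0 ≤ t → S t ∈ Icc (-l₂) l₁) ∧
    (∀ s t, 0 ≤ s → 0 ≤ t → |S s - S t| ≤ |s - t|)

/-- The search time `T(S,x) = inf {t ≥ 0 : S t = x}`, with value `∞` if `x` is never reached. -/
def searchTime (S : ℝ → ℝ) (x : ℝ) : ℝ≥0∞ :=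
  sInf (ENNReal.ofReal '' {t : ℝ | 0 ≤ t ∧ S t = x})

/-- The expected search time `T(S,h) = ∫_Q T(S,x) dh(x)`. -/
def expTime (S : ℝ → ℝ) (h : Measure ℝ) : ℝ≥0∞ :=
  ∫⁻ x, searchTime S x ∂h


/-- A search of the interval `[0, L]` starting from the root `t`:
a 1-Lipschitz function on `[0,∞)` with values in `[0,L]` and `S 0 = t`. -/
def IsSearchFrom (L t : ℝ) (S : ℝ → ℝ) : Prop :=
  S 0 = t ∧ (∀ s, 0 ≤ s → S s ∈ Icc 0 L) ∧
    (∀ s s' : ℝ, 0 ≤ s → 0 ≤ s' → |S s - S s'| ≤ |s - s'|)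

/-- The depth-first search from `t` that goes right first: unit speed from `t` to `L`,
then to `0`, then rests. -/
def SRight (L t : ℝ) (s : ℝ) : ℝ :=
  if s ≤ L - t then t + s else if s ≤ 2 * L - t then 2 * L - t - s else 0

/-- The depth-first search from `t` that goes left first: unit speed from `t` to `0`,
then to `L`, then rests. -/
def SLeft (L t : ℝ) (s : ℝ) : ℝ :=
  if s ≤ t then t - s else if s ≤ L + t then s - t else L

/-- The uniform distribution on `[0, L]`. -/
def unifL (L : ℝ) : Measure ℝ := (ENNReal.ofReal L)⁻¹ • (volume.restrict (Icc 0 L))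

section SearchTime

variable {L t : ℝ} {S : ℝ → ℝ}

lemma searchTime_le {s x : ℝ} (hs : 0 ≤ s) (hx : S s = x) :
    searchTime S x ≤ ENNReal.ofReal s :=
  sInf_le ⟨s, ⟨hs, hx⟩, rfl⟩

lemma IsSearchFrom.continuousOn (h : IsSearchFrom L t S) : ContinuousOn S (Ici 0) :=
  LipschitzOnWith.continuousOn (K := 1) <| LipschitzOnWith.of_dist_le_mul fun x hx y hy => by
    simpa [Real.dist_eq] using h.2.2 x y hx hy

/-- A finite search time is attained. -/
lemma IsSearchFrom.exists_eq_searchTime (h : IsSearchFrom L t S) {x : ℝ}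
    (hx : searchTime S x ≠ ∞) :
    ∃ m, 0 ≤ m ∧ S m = x ∧ searchTime S x = ENNReal.ofReal m := by
  set K : Set ℝ := {s | 0 ≤ s ∧ S s = x} with hK
  have hne : K.Nonempty := by
    by_contra hK'
    rw [not_nonempty_iff_eq_empty] at hK'
    apply hx
    simp [searchTime, ← hK, hK']
  have hcl : IsClosed K := h.continuousOn.preimage_isClosed_of_isClosed isClosed_Ici
    (isClosed_singleton (x := x))
  have hbdd : BddBelow K := ⟨0, fun s hs => hs.1⟩
  have hmem := hcl.csInf_mem hne hbdd
  refine ⟨sInf K, hmem.1, hmem.2, le_antisymm (searchTime_le hmem.1 hmem.2) ?_⟩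
  refine le_sInf ?_
  rintro _ ⟨s, hs, rfl⟩
  exact ENNReal.ofReal_le_ofReal (csInf_le hbdd hs)

lemma IsSearchFrom.measurable_searchTime (h : IsSearchFrom L t S) :
    Measurable (searchTime S) := by
  refine measurable_of_Iic fun c => ?_
  rcases eq_or_ne c ∞ with rfl | hc
  · simp
  · have : searchTime S ⁻¹' Iic c = S '' Icc 0 c.toReal := by
      ext x
      constructor
      · intro hx
        obtain ⟨m, hm, hSm, hT⟩ := h.exists_eq_searchTime (ne_top_of_le_ne_top hc hx)
        refine ⟨m, ⟨hm, ?_⟩, hSm⟩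
        rw [mem_preimage, mem_Iic, hT] at hx
        exact (ENNReal.ofReal_le_iff_le_toReal hc).1 hx
      · rintro ⟨s, hs, rfl⟩
        exact (searchTime_le hs.1 rfl).trans (ENNReal.ofReal_le_of_le_toReal hs.2)
    rw [this]
    exact (isCompact_Icc.image_of_continuousOn
      (h.continuousOn.mono Icc_subset_Ici_self)).measurableSet

lemma IsSearchFrom.searchTime_root (h : IsSearchFrom L t S) : searchTime S t = 0 := by
  simpa using searchTime_le le_rfl h.1

/-- Between the discoveries of two points the searcher has to travel their distance. -/
lemma IsSearchFrom.searchTime_add_le (h : IsSearchFrom L t S) {x y : ℝ}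
    (hxy : searchTime S y ≤ searchTime S x) :
    searchTime S y + ENNReal.ofReal |x - y| ≤ searchTime S x := by
  rcases eq_or_ne (searchTime S x) ∞ with hx | hx
  · simp [hx]
  obtain ⟨m, hm, hSm, hTm⟩ := h.exists_eq_searchTime hx
  obtain ⟨n, hn, hSn, hTn⟩ := h.exists_eq_searchTime (ne_top_of_le_ne_top hx hxy)
  rw [hTm, hTn, ENNReal.ofReal_le_ofReal_iff hm] at hxy
  rw [hTm, hTn, ← ENNReal.ofReal_add hn (abs_nonneg _)]
  apply ENNReal.ofReal_le_ofReal
  have := h.2.2 m n hm hn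
  rw [hSm, hSn, abs_of_nonneg (sub_nonneg.2 hxy)] at this
  linarith

/-- Points between the root and `x` are found before `x`. -/
lemma IsSearchFrom.searchTime_mono (h : IsSearchFrom L t S) {x y : ℝ} (hy : y ∈ uIcc t x) :
    searchTime S y ≤ searchTime S x := by
  rcases eq_or_ne (searchTime S x) ∞ with hx | hx
  · simp [hx]
  obtain ⟨m, hm, hSm, hTm⟩ := h.exists_eq_searchTime hx
  have hc : ContinuousOn S (uIcc 0 m) := h.continuousOn.mono (by
    rw [uIcc_of_le hm]; exact Icc_subset_Ici_self)
  have hy' : y ∈ uIcc (S 0) (S m) := by rwa [h.1, hSm]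
  obtain ⟨s, hs, hSs⟩ := intermediate_value_uIcc hc hy'
  rw [uIcc_of_le hm] at hs
  rw [hTm]
  exact (searchTime_le hs.1 hSs).trans (ENNReal.ofReal_le_ofReal hs.2)

lemma IsSearchFrom.dist_root_le_searchTime (h : IsSearchFrom L t S) (x : ℝ) :
    ENNReal.ofReal |x - t| ≤ searchTime S x := by
  have := h.searchTime_add_le (x := x) (y := t) (by simp [h.searchTime_root])
  simpa [h.searchTime_root] using this

/-- The points of `[0, L]` on the other side of `t` from `x` which `S` finds no later than `x`. -/
def foundBefore (L t : ℝ) (S : ℝ → ℝ) (x : ℝ) : Set ℝ :=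
  {y | y ∈ Icc 0 L ∧ (x - t) * (y - t) ≤ 0 ∧ searchTime S y ≤ searchTime S x}

/-- A lower bound for the search time of `x`: the searcher travels twice across
`foundBefore L t S x` before reaching `x`. -/
def timeBound (L t : ℝ) (S : ℝ → ℝ) (x : ℝ) : ℝ≥0∞ :=
  ENNReal.ofReal |x - t| + 2 * volume (foundBefore L t S x)

lemma abs_sub_eq_of_opposite {x y t : ℝ} (h : (x - t) * (y - t) ≤ 0) :
    |x - y| = |x - t| + |y - t| := by
  rcases le_total x t with hx | hx <;> rcases le_total y t with hy | hy <;>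
    rcases le_total x y with hxy | hxy <;>
    simp only [abs_of_nonneg, abs_of_nonpos, sub_nonneg, sub_nonpos, *] <;>
    nlinarith [mul_nonneg (sub_nonneg.2 hx) (sub_nonneg.2 hy)]

/-- A set lying on one side of `t`, within distance `c`, has measure at most `c`. -/
lemma volume_le_of_opposite {A : Set ℝ} {x t c : ℝ}
    (hA : ∀ y ∈ A, (x - t) * (y - t) ≤ 0 ∧ |y - t| ≤ c) (hxt : x ≠ t) :
    volume A ≤ ENNReal.ofReal c := by
  rcases lt_or_gt_of_ne hxt with hx | hx
  · have : A ⊆ Icc t (t + c) := fun y hy => by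
      obtain ⟨h1, h2⟩ := hA y hy
      rw [abs_le] at h2
      constructor <;> nlinarith
    simpa using measure_mono (μ := volume) this
  · have : A ⊆ Icc (t - c) t := fun y hy => by
      obtain ⟨h1, h2⟩ := hA y hy
      rw [abs_le] at h2
      constructor <;> nlinarith
    simpa using measure_mono (μ := volume) this

lemma IsSearchFrom.searchTime_eq_top_or (h : IsSearchFrom L t S) (x : ℝ) :
    searchTime S x = ∞ ∨ ∃ c, 0 ≤ c ∧ searchTime S x = ENNReal.ofReal (|x - t| + 2 * c) := by
  refine or_iff_not_imp_left.2 fun hx => ?_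
  obtain ⟨m, hm, -, hT⟩ := h.exists_eq_searchTime hx
  have := h.dist_root_le_searchTime x
  rw [hT, ENNReal.ofReal_le_ofReal_iff hm] at this
  exact ⟨(m - |x - t|) / 2, by linarith, by rw [hT]; congr 1; ring⟩

lemma ofReal_add_two_mul {a c : ℝ} (ha : 0 ≤ a) (hc : 0 ≤ c) :
    ENNReal.ofReal (a + 2 * c) = ENNReal.ofReal a + 2 * ENNReal.ofReal c := by
  rw [ENNReal.ofReal_add ha (by positivity), ENNReal.ofReal_mul (by norm_num)]
  simp

lemma IsSearchFrom.timeBound_le (h : IsSearchFrom L t S) {x : ℝ} (hxt : x ≠ t) :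
    timeBound L t S x ≤ searchTime S x := by
  rcases h.searchTime_eq_top_or x with hx | ⟨c, hc, hT⟩
  · simp [hx]
  rw [hT, timeBound, ofReal_add_two_mul (abs_nonneg _) hc]
  gcongr
  refine volume_le_of_opposite (x := x) (fun y hy => ⟨hy.2.1, ?_⟩) hxt
  have h1 := h.searchTime_add_le hy.2.2
  have h2 := (add_le_add_left (h.dist_root_le_searchTime y) _).trans h1
  rw [hT, ← ENNReal.ofReal_add (abs_nonneg _) (abs_nonneg _),
    ENNReal.ofReal_le_ofReal_iff (by positivity), abs_sub_eq_of_opposite hy.2.1] at h2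
  linarith

end SearchTime

section Cost

variable {L t : ℝ} {S : ℝ → ℝ}

lemma lintegral_Icc_dist (ht : t ∈ Icc 0 L) :
    ∫⁻ x in Icc 0 L, ENNReal.ofReal |x - t| = ENNReal.ofReal ((t ^ 2 + (L - t) ^ 2) / 2) := by
  have hL : 0 ≤ L := ht.1.trans ht.2
  have hcont : Continuous fun x : ℝ => |x - t| := by fun_prop
  rw [← ofReal_integral_eq_lintegral_ofReal hcont.integrableOn_Icc
    (Eventually.of_forall fun x => abs_nonneg _), integral_Icc_eq_integral_Ioc,
    ← intervalIntegral.integral_of_le hL,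
    ← intervalIntegral.integral_add_adjacent_intervals (hcont.intervalIntegrable 0 t)
      (hcont.intervalIntegrable t L)]
  congr 1
  have h1 : ∫ x in (0 : ℝ)..t, |x - t| = ∫ x in (0 : ℝ)..t, (t - x) :=
    intervalIntegral.integral_congr fun x hx => by
      rw [uIcc_of_le ht.1] at hx
      rw [abs_of_nonpos (by linarith [hx.2]), neg_sub]
  have h2 : ∫ x in t..L, |x - t| = ∫ x in t..L, (x - t) :=
    intervalIntegral.integral_congr fun x hx => by
      rw [uIcc_of_le ht.2] at hx
      rw [abs_of_nonneg (by linarith [hx.1])]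
  rw [h1, h2, intervalIntegral.integral_sub (by simp) (by simp),
    intervalIntegral.integral_sub (by simp) (by simp)]
  simp
  ring

/-- The pairs `(x, y)` on opposite sides of the root such that `y` is found no later than `x`. -/
def oppositePairs (t : ℝ) (S : ℝ → ℝ) : Set (ℝ × ℝ) :=
  {z | (z.1 - t) * (z.2 - t) ≤ 0 ∧ searchTime S z.2 ≤ searchTime S z.1}

lemma IsSearchFrom.measurableSet_oppositePairs (h : IsSearchFrom L t S) :
    MeasurableSet (oppositePairs t S) := by
  have hT := h.measurable_searchTime
  exact (measurableSet_le ((measurable_fst.sub_const t).mul (measurable_snd.sub_const t))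
    measurable_const).inter
    (measurableSet_le (hT.comp measurable_snd) (hT.comp measurable_fst))

lemma IsSearchFrom.volume_foundBefore (h : IsSearchFrom L t S) (x : ℝ) :
    volume (foundBefore L t S x) =
      (volume.restrict (Icc 0 L)) (Prod.mk x ⁻¹' oppositePairs t S) := by
  rw [Measure.restrict_apply (measurable_prodMk_left h.measurableSet_oppositePairs)]
  congr 1
  ext y
  simp only [foundBefore, oppositePairs, mem_ofPred_eq, mem_inter_iff, mem_preimage]
  tauto

/-- Either order of a pair of points on opposite sides of the root occurs in `oppositePairs`. -/
lemma IsSearchFrom.le_prod_oppositePairs (h : IsSearchFrom L t S) (ht : t ∈ Icc 0 L) :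
    ENNReal.ofReal (2 * (t * (L - t))) ≤
      2 * ((volume.restrict (Icc 0 L)).prod (volume.restrict (Icc 0 L))) (oppositePairs t S) := by
  set μ : Measure ℝ := volume.restrict (Icc 0 L) with hμ
  set D := oppositePairs t S
  have hD := h.measurableSet_oppositePairs
  have hswap : (μ.prod μ) (Prod.swap ⁻¹' D) = (μ.prod μ) D :=
    Measure.measurePreserving_swap.measure_preimage hD.nullMeasurableSet
  have h1 : μ (Ico 0 t) = ENNReal.ofReal t := by
    rw [hμ, Measure.restrict_apply measurableSet_Ico,
      inter_eq_left.2 (Ico_subset_Icc_self.trans (Icc_subset_Icc_right ht.2))]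
    simp
  have h2 : μ (Icc t L) = ENNReal.ofReal (L - t) := by
    rw [hμ, Measure.restrict_apply measurableSet_Icc,
      inter_eq_left.2 (Icc_subset_Icc_left ht.1)]
    simp
  have hdisj : Disjoint (Ico 0 t ×ˢ Icc t L) (Icc t L ×ˢ Ico 0 t) := by
    rw [Set.disjoint_left]
    rintro ⟨x, y⟩ ⟨hx, -⟩ ⟨hx', -⟩
    exact absurd hx.2 (not_lt.2 hx'.1)
  have hsub : Ico 0 t ×ˢ Icc t L ∪ Icc t L ×ˢ Ico 0 t ⊆ D ∪ Prod.swap ⁻¹' D := by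
    rintro ⟨x, y⟩ hxy
    have hopp : (x - t) * (y - t) ≤ 0 := by
      rcases hxy with ⟨hx, hy⟩ | ⟨hx, hy⟩
      · exact mul_nonpos_of_nonpos_of_nonneg (sub_nonpos.2 hx.2.le) (sub_nonneg.2 hy.1)
      · exact mul_nonpos_of_nonneg_of_nonpos (sub_nonneg.2 hx.1) (sub_nonpos.2 hy.2.le)
    rcases le_total (searchTime S y) (searchTime S x) with hT | hT
    · exact Or.inl ⟨hopp, hT⟩
    · exact Or.inr ⟨by simpa [mul_comm] using hopp, hT⟩
  calc ENNReal.ofReal (2 * (t * (L - t)))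
      = (μ.prod μ) (Ico 0 t ×ˢ Icc t L ∪ Icc t L ×ˢ Ico 0 t) := by
        rw [measure_union hdisj (measurableSet_Icc.prod measurableSet_Ico), Measure.prod_prod,
          Measure.prod_prod, h1, h2, ← ENNReal.ofReal_mul ht.1,
          ← ENNReal.ofReal_mul (sub_nonneg.2 ht.2), ← ENNReal.ofReal_add
            (mul_nonneg ht.1 (sub_nonneg.2 ht.2)) (mul_nonneg (sub_nonneg.2 ht.2) ht.1)]
        congr 1
        ring
    _ ≤ (μ.prod μ) (D ∪ Prod.swap ⁻¹' D) := measure_mono hsub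
    _ ≤ (μ.prod μ) D + (μ.prod μ) (Prod.swap ⁻¹' D) := measure_union_le _ _
    _ = 2 * (μ.prod μ) D := by rw [hswap, two_mul]

lemma IsSearchFrom.measurable_timeBound (h : IsSearchFrom L t S) :
    Measurable (timeBound L t S) := by
  have : Measurable fun x => volume (foundBefore L t S x) := by
    simp_rw [h.volume_foundBefore]
    exact measurable_measure_prodMk_left h.measurableSet_oppositePairs
  unfold timeBound
  fun_prop

lemma IsSearchFrom.le_lintegral_timeBound (h : IsSearchFrom L t S) (ht : t ∈ Icc 0 L) :
    ENNReal.ofReal (L ^ 2 - (t ^ 2 + (L - t) ^ 2) / 2) ≤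
      ∫⁻ x in Icc 0 L, timeBound L t S x := by
  unfold timeBound
  have hm : Measurable fun x : ℝ => ENNReal.ofReal |x - t| := by fun_prop
  rw [lintegral_add_left hm, lintegral_Icc_dist ht, lintegral_const_mul' _ _ (by simp)]
  simp_rw [h.volume_foundBefore]
  rw [← Measure.prod_apply h.measurableSet_oppositePairs]
  refine le_trans (le_of_eq ?_) (add_le_add_right (h.le_prod_oppositePairs ht) _)
  rw [← ENNReal.ofReal_add (by positivity)
    (mul_nonneg zero_le_two (mul_nonneg ht.1 (sub_nonneg.2 ht.2)))]
  congr 1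
  ring

lemma IsSearchFrom.timeBound_ae_le (h : IsSearchFrom L t S) :
    timeBound L t S ≤ᵐ[volume.restrict (Icc 0 L)] searchTime S :=
  ae_restrict_of_ae <| (Measure.ae_ne volume t).mono fun _ hx => h.timeBound_le hx

/-- The optimal expected search time from the root `t`. -/
def optTime (L t : ℝ) : ℝ := L - (t ^ 2 + (L - t) ^ 2) / (2 * L)

lemma expTime_unifL (L : ℝ) (S : ℝ → ℝ) :
    expTime S (unifL L) = (ENNReal.ofReal L)⁻¹ * ∫⁻ x in Icc 0 L, searchTime S x := by
  simp [expTime, unifL, lintegral_smul_measure]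

lemma ofReal_optTime (hL : 0 < L) (t : ℝ) :
    ENNReal.ofReal (optTime L t) =
      (ENNReal.ofReal L)⁻¹ * ENNReal.ofReal (L ^ 2 - (t ^ 2 + (L - t) ^ 2) / 2) := by
  rw [← ENNReal.ofReal_inv_of_pos hL, ← ENNReal.ofReal_mul (by positivity), optTime]
  congr 1
  field_simp

lemma IsSearchFrom.optTime_le_expTime (h : IsSearchFrom L t S) (hL : 0 < L) (ht : t ∈ Icc 0 L) :
    ENNReal.ofReal (optTime L t) ≤ expTime S (unifL L) := by
  rw [expTime_unifL, ofReal_optTime hL]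
  gcongr
  exact (h.le_lintegral_timeBound ht).trans (lintegral_mono_ae h.timeBound_ae_le)

/-- For an optimal search the lower bound on the search time is attained almost everywhere. -/
lemma IsSearchFrom.searchTime_ae_eq (h : IsSearchFrom L t S) (hL : 0 < L) (ht : t ∈ Icc 0 L)
    (hopt : expTime S (unifL L) ≤ ENNReal.ofReal (optTime L t)) :
    ∀ᵐ x ∂volume.restrict (Icc 0 L),
      searchTime S x = timeBound L t S x ∧ searchTime S x ≠ ∞ := by
  rw [expTime_unifL, ofReal_optTime hL, ENNReal.mul_le_mul_iff_right (by simp) (by simpa)] at hopt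
  have hle := hopt.trans (h.le_lintegral_timeBound ht)
  have hfin : ∫⁻ x in Icc 0 L, timeBound L t S x ≠ ∞ :=
    ne_top_of_le_ne_top ENNReal.ofReal_ne_top
      ((lintegral_mono_ae h.timeBound_ae_le).trans hopt)
  filter_upwards [ae_eq_of_ae_le_of_lintegral_le h.timeBound_ae_le hfin
    h.measurable_searchTime.aemeasurable hle, ae_lt_top h.measurable_timeBound hfin] with x hx hx'
  exact ⟨hx.symm, hx ▸ hx'.ne⟩

end Cost

section Reflection

variable {L t : ℝ} {S : ℝ → ℝ}

lemma IsSearchFrom.reflect (h : IsSearchFrom L t S) :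
    IsSearchFrom L (L - t) fun s => L - S s := by
  refine ⟨by simp [h.1], fun s hs => ?_, fun s s' hs hs' => ?_⟩
  · obtain ⟨h1, h2⟩ := h.2.1 s hs
    exact ⟨by linarith, by linarith⟩
  · rw [sub_sub_sub_cancel_left, abs_sub_comm]
    exact h.2.2 s s' hs hs'

lemma searchTime_reflect (L : ℝ) (S : ℝ → ℝ) (x : ℝ) :
    searchTime (fun s => L - S s) x = searchTime S (L - x) := by
  unfold searchTime
  congr 2
  ext s
  exact and_congr_right fun _ => ⟨fun h => by linarith, fun h => by linarith⟩

lemma expTime_reflect (L : ℝ) (S : ℝ → ℝ) :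
    expTime (fun s => L - S s) (unifL L) = expTime S (unifL L) := by
  rw [expTime_unifL, expTime_unifL, ← lintegral_indicator measurableSet_Icc,
    ← lintegral_indicator measurableSet_Icc,
    ← lintegral_sub_left_eq_self ((Icc 0 L).indicator (searchTime S)) L]
  congr 2 with x
  have : L - x ∈ Icc 0 L ↔ x ∈ Icc 0 L :=
    ⟨fun h => ⟨by linarith [h.2], by linarith [h.1]⟩,
      fun h => ⟨by linarith [h.2], by linarith [h.1]⟩⟩
  simp only [indicator, this, searchTime_reflect]

lemma optTime_reflect (L t : ℝ) : optTime L (L - t) = optTime L t := by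
  unfold optTime
  ring

lemma SLeft_eq_reflect (L t : ℝ) : SLeft L t = fun s => L - SRight L (L - t) s := by
  ext s
  unfold SLeft SRight
  split_ifs <;> linarith

lemma reflect_mem_Icc (ht : t ∈ Icc 0 L) : L - t ∈ Icc 0 L :=
  ⟨sub_nonneg.2 ht.2, sub_le_self _ ht.1⟩

end Reflection

section DepthFirst

variable {L t : ℝ}

lemma isSearchFrom_SRight (ht : t ∈ Icc 0 L) : IsSearchFrom L t (SRight L t) := by
  obtain ⟨h0, hL⟩ := ht
  refine ⟨by simp [SRight, hL], fun s hs => ?_, fun s s' hs hs' => ?_⟩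
  · unfold SRight
    split_ifs <;> constructor <;> linarith
  · rcases le_total s s' with hss | hss
    · rw [abs_of_nonpos (sub_nonpos.2 hss), abs_le]
      unfold SRight
      split_ifs <;> constructor <;> linarith
    · rw [abs_of_nonneg (sub_nonneg.2 hss), abs_le]
      unfold SRight
      split_ifs <;> constructor <;> linarith

lemma isSearchFrom_SLeft (ht : t ∈ Icc 0 L) : IsSearchFrom L t (SLeft L t) := by
  simpa [SLeft_eq_reflect] using (isSearchFrom_SRight (reflect_mem_Icc ht)).reflect

lemma searchTime_SRight_le {x : ℝ} (ht : t ∈ Icc 0 L) (hx : x ∈ Icc 0 L) :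
    searchTime (SRight L t) x ≤ ENNReal.ofReal |x - t| +
      (Iio t).indicator (fun _ => ENNReal.ofReal (2 * (L - t))) x := by
  obtain ⟨h0, hL⟩ := ht
  rcases lt_or_ge x t with hxt | hxt
  · rw [indicator_of_mem (by exact hxt), ← ENNReal.ofReal_add (abs_nonneg _) (by linarith),
      abs_of_neg (by linarith)]
    refine searchTime_le (by linarith) ?_
    unfold SRight
    split_ifs <;> linarith [hx.1]
  · rw [indicator_of_notMem (by simpa), add_zero, abs_of_nonneg (by linarith)]
    refine searchTime_le (by linarith) ?_
    unfold SRight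
    split_ifs <;> linarith [hx.2]

lemma expTime_SRight_le (hL : 0 < L) (ht : t ∈ Icc 0 L) :
    expTime (SRight L t) (unifL L) ≤ ENNReal.ofReal (optTime L t) := by
  rw [expTime_unifL, ofReal_optTime hL]
  gcongr
  have hm : Measurable fun x : ℝ => ENNReal.ofReal |x - t| := by fun_prop
  have hsub : Iio t ∩ Icc 0 L = Ico 0 t := by
    ext x
    exact ⟨fun h => ⟨h.2.1, h.1⟩, fun h => ⟨h.2, h.1, h.2.le.trans ht.2⟩⟩
  have hLt := sub_nonneg.2 ht.2
  calc ∫⁻ x in Icc 0 L, searchTime (SRight L t) x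
      ≤ ∫⁻ x in Icc 0 L, (ENNReal.ofReal |x - t| +
          (Iio t).indicator (fun _ => ENNReal.ofReal (2 * (L - t))) x) :=
        setLIntegral_mono' measurableSet_Icc fun x hx => searchTime_SRight_le ht hx
    _ = ENNReal.ofReal ((t ^ 2 + (L - t) ^ 2) / 2) +
          ENNReal.ofReal (2 * (L - t)) * ENNReal.ofReal t := by
        rw [lintegral_add_left hm, lintegral_Icc_dist ht,
          lintegral_indicator_const measurableSet_Iio, Measure.restrict_apply measurableSet_Iio,
          hsub]
        simp
    _ = ENNReal.ofReal (L ^ 2 - (t ^ 2 + (L - t) ^ 2) / 2) := by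
        rw [← ENNReal.ofReal_mul (by positivity), ← ENNReal.ofReal_add (by positivity)
          (mul_nonneg (by positivity) ht.1)]
        congr 1
        ring

lemma expTime_SLeft_le (hL : 0 < L) (ht : t ∈ Icc 0 L) :
    expTime (SLeft L t) (unifL L) ≤ ENNReal.ofReal (optTime L t) := by
  rw [SLeft_eq_reflect, expTime_reflect, ← optTime_reflect]
  exact expTime_SRight_le hL (reflect_mem_Icc ht)

lemma iInf_expTime_eq (hL : 0 < L) (ht : t ∈ Icc 0 L) :
    ⨅ S : {S : ℝ → ℝ // IsSearchFrom L t S}, expTime S.1 (unifL L) =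
      ENNReal.ofReal (optTime L t) :=
  le_antisymm ((iInf_le _ ⟨_, isSearchFrom_SRight ht⟩).trans (expTime_SRight_le hL ht))
    (le_iInf fun S => S.2.optTime_le_expTime hL ht)

lemma optTime_sub_half (hL : 0 < L) (t : ℝ) : optTime L t - L / 2 = t * (L - t) / L := by
  unfold optTime
  field_simp
  ring

end DepthFirst

section Optimal

variable {L t : ℝ} {S : ℝ → ℝ}

lemma exists_mem_Ioo_of_ae {P : ℝ → Prop} {a b : ℝ}
    (hP : ∀ᵐ x ∂volume.restrict (Icc 0 L), P x) (ha : 0 ≤ a) (hab : a < b) (hb : b ≤ L) :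
    ∃ x ∈ Ioo a b, P x := by
  have h1 : ∀ᵐ x ∂volume.restrict (Ioo a b), P x :=
    ae_restrict_of_ae_restrict_of_subset
      (Ioo_subset_Icc_self.trans (Icc_subset_Icc ha hb)) hP
  have : NeBot (ae (volume.restrict (Ioo a b))) := by
    rw [ae_neBot, Ne, Measure.restrict_eq_zero]
    simpa using hab
  obtain ⟨x, hx, hx'⟩ := ((ae_restrict_mem measurableSet_Ioo).and h1).exists
  exact ⟨x, hx, hx'⟩

/-- An optimal search does not visit a point right of the root between discoveries of points
left of the root. -/
lemma IsSearchFrom.not_interleaved (h : IsSearchFrom L t S) (hL : 0 < L) (ht : t ∈ Icc 0 L)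
    (hopt : expTime S (unifL L) ≤ ENNReal.ofReal (optTime L t)) {p q r : ℝ}
    (hp : p < t) (hq : t ≤ q) (hr : 0 < r) (hrt : r ≤ t)
    (hpq : searchTime S p ≤ searchTime S q) : searchTime S r < searchTime S q := by
  by_contra! hqr
  obtain ⟨x, ⟨hx0, hxr⟩, hx, hxtop⟩ :=
    exists_mem_Ioo_of_ae (h.searchTime_ae_eq hL ht hopt) le_rfl hr (hrt.trans ht.2)
  have hxt : x < t := hxr.trans_le hrt
  obtain ⟨c, hc, hT⟩ := (h.searchTime_eq_top_or x).resolve_left hxtop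
  have hqx : searchTime S q ≤ searchTime S x :=
    hqr.trans (h.searchTime_mono (by rw [uIcc_of_ge hxt.le]; exact ⟨hxr.le, hrt⟩))
  -- A detour to `p` precedes the discovery of every point right of `q`.
  have hfar : ∀ y, q ≤ y → ENNReal.ofReal (2 * (t - p) + (y - t)) ≤ searchTime S y := by
    intro y hy
    have hqy := h.searchTime_mono (x := y) (y := q) (by
      rw [uIcc_of_le (hq.trans hy)]; exact ⟨hq, hy⟩)
    have h1 := h.searchTime_add_le (hpq.trans hqy)
    have h2 := (add_le_add_left (h.dist_root_le_searchTime p) _).trans h1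
    rw [← ENNReal.ofReal_add (abs_nonneg _) (abs_nonneg _), abs_of_neg (by linarith),
      abs_of_nonneg (by linarith)] at h2
    exact le_of_eq_of_le (by congr 1; ring) h2
  have hbound : ∀ y, q ≤ y → searchTime S y ≤ searchTime S x → y - t ≤ c - (t - p) := by
    intro y hy hyx
    have h1 := (add_le_add_left (hfar y hy) _).trans (h.searchTime_add_le hyx)
    rw [hT, ← ENNReal.ofReal_add (by linarith) (abs_nonneg _), ENNReal.ofReal_le_ofReal_iff
      (by positivity), abs_of_neg (by linarith), abs_of_neg (by linarith)] at h1
    linarith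
  have hcq := hbound q le_rfl hqx
  have hvol : volume (foundBefore L t S x) ≤ ENNReal.ofReal (c - (t - p)) := by
    refine volume_le_of_opposite (x := x) (fun y hy => ⟨hy.2.1, ?_⟩) hxt.ne
    have hyt : t ≤ y := by nlinarith [hy.2.1]
    rw [abs_of_nonneg (by linarith)]
    rcases le_total q y with hqy | hqy
    · exact hbound y hqy hy.2.2
    · linarith
  rw [timeBound, hT, ofReal_add_two_mul (abs_nonneg _) hc,
    ENNReal.add_right_inj ENNReal.ofReal_ne_top,
    ENNReal.mul_right_inj (by simp) (by simp)] at hx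
  rw [← hx, ENNReal.ofReal_le_ofReal_iff (by linarith)] at hvol
  linarith

lemma IsSearchFrom.eq_SRight (h : IsSearchFrom L t S) (hL : 0 < L) (ht : t ∈ Icc 0 L)
    (hopt : expTime S (unifL L) ≤ ENNReal.ofReal (optTime L t)) (ht0 : 0 < t)
    (hord : ∀ q ∈ Ico t L, ∀ p ∈ Ioo 0 t, searchTime S q < searchTime S p) :
    ∀ s ∈ Icc 0 (2 * L - t), S s = SRight L t s := by
  have hae := h.searchTime_ae_eq hL ht hopt
  have hLt := ht.2
  have hattain : ∀ x, searchTime S x ≠ ∞ → ∀ c, 0 ≤ c → searchTime S x = ENNReal.ofReal c →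
      S c = x := by
    intro x hx c hc hT
    obtain ⟨m, hm, hSm, hTm⟩ := h.exists_eq_searchTime hx
    rw [hT, ENNReal.ofReal_eq_ofReal_iff hc hm] at hTm
    rwa [hTm]
  have hright : S (L - t) = L := by
    rcases hLt.eq_or_lt with rfl | hLt
    · simpa using h.1
    refine le_antisymm (h.2.1 _ (by linarith)).2 (le_of_forall_pos_sub_le fun ε hε => ?_)
    obtain ⟨q, ⟨hq, hqL⟩, hTq, hfin⟩ := exists_mem_Ioo_of_ae hae
      (a := max t (L - ε / 2)) (ht.1.trans (le_max_left _ _)) (max_lt hLt (by linarith)) le_rfl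
    rw [max_lt_iff] at hq
    have hnull : volume (foundBefore L t S q) = 0 := by
      refine measure_mono_null (t := {0, t}) (fun y hy => ?_) ((Set.toFinite _).measure_zero _)
      have hyt : y ≤ t := by nlinarith [hy.2.1]
      by_contra hy'
      simp only [mem_insert_iff, mem_singleton_iff, not_or] at hy'
      exact absurd hy.2.2 (not_le.2 (hord q ⟨hq.1.le, hqL⟩ y
        ⟨lt_of_le_of_ne hy.1.1 (Ne.symm hy'.1), lt_of_le_of_ne hyt hy'.2⟩))
    rw [timeBound, hnull, mul_zero, add_zero, abs_of_pos (by linarith)] at hTq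
    have hSq := hattain q hfin (q - t) (by linarith) hTq
    have hlip := h.2.2 (q - t) (L - t) (by linarith) (by linarith)
    rw [hSq, abs_of_nonpos (by linarith : q - t - (L - t) ≤ 0), abs_le] at hlip
    linarith
  have hleft : S (2 * L - t) = 0 := by
    refine le_antisymm (le_of_forall_pos_le_add fun ε hε => ?_) (h.2.1 _ (by linarith)).1
    obtain ⟨p, ⟨hp0, hp⟩, hTp, hfin⟩ := exists_mem_Ioo_of_ae hae (a := 0) (b := min (ε / 2) t)
      le_rfl (lt_min (by linarith) ht0) ((min_le_right _ _).trans hLt)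
    rw [lt_min_iff] at hp
    have hvol : volume (foundBefore L t S p) = ENNReal.ofReal (L - t) := by
      apply le_antisymm
      · have : foundBefore L t S p ⊆ Icc t L := fun y hy => ⟨by nlinarith [hy.2.1], hy.1.2⟩
        simpa using measure_mono (μ := volume) this
      · have : Ico t L ⊆ foundBefore L t S p := fun y hy =>
          ⟨⟨ht.1.trans hy.1, hy.2.le⟩,
            mul_nonpos_of_nonpos_of_nonneg (by linarith) (sub_nonneg.2 hy.1),
            (hord y hy p ⟨hp0, hp.2⟩).le⟩
        simpa using measure_mono (μ := volume) this
    rw [timeBound, hvol, ← ofReal_add_two_mul (abs_nonneg _) (by linarith),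
      abs_of_neg (by linarith)] at hTp
    have hSp := hattain p hfin _ (by linarith) hTp
    have hlip := h.2.2 (-(p - t) + 2 * (L - t)) (2 * L - t) (by linarith) (by linarith)
    rw [hSp, abs_of_nonpos (by linarith : -(p - t) + 2 * (L - t) - (2 * L - t) ≤ 0), abs_le]
      at hlip
    linarith
  intro s hs
  unfold SRight
  split_ifs with h1 h2
  · have ha := abs_le.1 (h.2.2 0 s le_rfl hs.1)
    have hb := abs_le.1 (h.2.2 s (L - t) hs.1 (by linarith))
    rw [h.1, abs_of_nonpos (by linarith [hs.1])] at ha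
    rw [hright, abs_of_nonpos (by linarith)] at hb
    linarith
  · have ha := abs_le.1 (h.2.2 (L - t) s (by linarith) hs.1)
    have hb := abs_le.1 (h.2.2 s (2 * L - t) hs.1 (by linarith))
    rw [hright, abs_of_nonpos (by linarith)] at ha
    rw [hleft, abs_of_nonpos (by linarith)] at hb
    linarith
  · exact absurd hs.2 h2

lemma IsSearchFrom.eq_SLeft (h : IsSearchFrom L t S) (hL : 0 < L) (ht : t ∈ Icc 0 L)
    (hopt : expTime S (unifL L) ≤ ENNReal.ofReal (optTime L t)) (htL : t < L)
    (hord : ∀ p ∈ Ioc 0 t, ∀ q ∈ Ioo t L, searchTime S p < searchTime S q) :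
    ∀ s ∈ Icc 0 (L + t), S s = SLeft L t s := by
  intro s hs
  have := h.reflect.eq_SRight hL (reflect_mem_Icc ht)
    (by rwa [expTime_reflect, optTime_reflect]) (sub_pos.2 htL) (fun q hq p hp => by
      rw [searchTime_reflect, searchTime_reflect]
      exact hord _ ⟨by linarith [hq.2], by linarith [hq.1]⟩ _
        ⟨by linarith [hp.2], by linarith [hp.1]⟩) s ⟨hs.1, by linarith [hs.2]⟩
  simp [SLeft_eq_reflect, ← this]

lemma IsSearchFrom.eq_SRight_or_eq_SLeft (h : IsSearchFrom L t S) (hL : 0 < L)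
    (ht : t ∈ Icc 0 L) (hopt : expTime S (unifL L) ≤ ENNReal.ofReal (optTime L t)) :
    (∀ s ∈ Icc 0 (2 * L - t), S s = SRight L t s) ∨
      (∀ s ∈ Icc 0 (L + t), S s = SLeft L t s) := by
  rcases ht.1.eq_or_lt with ht0 | ht0
  · exact Or.inr (h.eq_SLeft hL ht hopt (ht0 ▸ hL) fun p hp =>
      absurd (hp.1.trans_le hp.2) (ht0 ▸ lt_irrefl _))
  rcases ht.2.eq_or_lt with htL | htL
  · exact Or.inl (h.eq_SRight hL ht hopt ht0 fun q hq =>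
      absurd (hq.1.trans_lt hq.2) (htL ▸ lt_irrefl _))
  by_cases hcase : ∀ q ∈ Ico t L, ∀ p ∈ Ioo 0 t, searchTime S q < searchTime S p
  · exact Or.inl (h.eq_SRight hL ht hopt ht0 hcase)
  push Not at hcase
  obtain ⟨q₀, hq₀, p₀, hp₀, hpq₀⟩ := hcase
  have hleft : ∀ p ∈ Ioc 0 t, searchTime S p < searchTime S q₀ := fun p hp =>
    h.not_interleaved hL ht hopt hp₀.2 hq₀.1 hp.1 hp.2 hpq₀
  have htq₀ : t < q₀ := by
    refine lt_of_le_of_ne hq₀.1 fun heq => ?_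
    simpa [← heq, h.searchTime_root] using hleft p₀ ⟨hp₀.1, hp₀.2.le⟩
  refine Or.inr (h.eq_SLeft hL ht hopt htL fun p hp q hq => ?_)
  by_contra! hqp
  have := h.reflect.not_interleaved hL (reflect_mem_Icc ht)
    (by rwa [expTime_reflect, optTime_reflect]) (p := L - q) (q := L - p) (r := L - q₀)
    (by linarith [hq.1]) (by linarith [hp.2]) (by linarith [hq₀.2])
    (by linarith) (by simpa [searchTime_reflect] using hqp)
  simp only [searchTime_reflect, sub_sub_cancel] at this
  exact lt_asymm this (hleft p hp)

end Optimal

/-- For the uniform distribution on `[0,L]` with root `t`: the two depth-first searches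
are optimal, every optimal search coincides with one of them until the interval is
covered, the value is `V(t) = L - (t² + (L-t)²)/(2L)`, and `V(t) ≥ L/2` with equality
exactly at the endpoints. -/
theorem uniform_interval_root_choice (L : ℝ) (hL : 0 < L) :
    ∀ t ∈ Icc (0 : ℝ) L,
      IsSearchFrom L t (SRight L t) ∧
      IsSearchFrom L t (SLeft L t) ∧
      (∀ S' : ℝ → ℝ, IsSearchFrom L t S' →
        expTime (SRight L t) (unifL L) ≤ expTime S' (unifL L)) ∧
      (∀ S' : ℝ → ℝ, IsSearchFrom L t S' →
        expTime (SLeft L t) (unifL L) ≤ expTime S' (unifL L)) ∧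
      (∀ S : ℝ → ℝ, IsSearchFrom L t S →
        (∀ S' : ℝ → ℝ, IsSearchFrom L t S' → expTime S (unifL L) ≤ expTime S' (unifL L)) →
        (∀ s ∈ Icc (0 : ℝ) (2 * L - t), S s = SRight L t s) ∨
          (∀ s ∈ Icc (0 : ℝ) (L + t), S s = SLeft L t s)) ∧
      (⨅ S : {S : ℝ → ℝ // IsSearchFrom L t S}, expTime S.1 (unifL L))
        = ENNReal.ofReal (L - (t ^ 2 + (L - t) ^ 2) / (2 * L)) ∧
      ENNReal.ofReal (L / 2)
        ≤ (⨅ S : {S : ℝ → ℝ // IsSearchFrom L t S}, expTime S.1 (unifL L)) ∧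
      ((⨅ S : {S : ℝ → ℝ // IsSearchFrom L t S}, expTime S.1 (unifL L))
          = ENNReal.ofReal (L / 2) ↔ t = 0 ∨ t = L) := by
  intro t ht
  have hR := isSearchFrom_SRight ht
  have hV := iInf_expTime_eq hL ht
  have hhalf := optTime_sub_half hL t
  have hnn : 0 ≤ t * (L - t) / L :=
    div_nonneg (mul_nonneg ht.1 (sub_nonneg.2 ht.2)) hL.le
  refine ⟨hR, isSearchFrom_SLeft ht,
    fun S' hS' => (expTime_SRight_le hL ht).trans (hS'.optTime_le_expTime hL ht),
    fun S' hS' => (expTime_SLeft_le hL ht).trans (hS'.optTime_le_expTime hL ht),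
    fun S hS hopt => hS.eq_SRight_or_eq_SLeft hL ht
      ((hopt _ hR).trans (expTime_SRight_le hL ht)), hV, ?_, ?_⟩
  · rw [hV]
    exact ENNReal.ofReal_le_ofReal (by linarith)
  · rw [hV, ENNReal.ofReal_eq_ofReal_iff (by linarith) (by linarith), ← sub_eq_zero, hhalf,
      div_eq_zero_iff, mul_eq_zero, sub_eq_zero, or_iff_left hL.ne', eq_comm (a := L)]

end
end

section
/- Assume the hiding distribution h on Q satisfies h({0}) = 0. For 0 < x < λ₁, let S*(x) be the single-turn search that moves at unit speed from 0 to x, then to −λ₂, then to λ₁ (and is constant thereafter). Then T(S*(x),h) < T(S⁺,h) if and only if F₁(x) > (x + h₁μ − λ₁)/(x + λ₂). -/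
open MeasureTheory Set Filter
open scoped ENNReal

noncomputable section

/-- The depth-first search `S⁺`: unit speed from `0` to `l₁`, then to `-l₂`, then rests. -/
def Splus (l₁ l₂ : ℝ) (t : ℝ) : ℝ :=
  if t ≤ l₁ then t else if t ≤ 2 * l₁ + l₂ then 2 * l₁ - t else -l₂

/-- The depth-first search `S⁻`: unit speed from `0` to `-l₂`, then to `l₁`, then rests. -/
def Sminus (l₁ l₂ : ℝ) (t : ℝ) : ℝ :=
  if t ≤ l₂ then -t else if t ≤ 2 * l₂ + l₁ then t - 2 * l₂ else l₁

/-- A hiding distribution is balanced if the two branches at the root have equal search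
density: `λ₂ · h((0,λ₁]) = λ₁ · h([-λ₂,0))`. -/
def BalancedDist (l₁ l₂ : ℝ) (h : Measure ℝ) : Prop :=
  l₂ * (h (Ioc 0 l₁)).toReal = l₁ * (h (Ico (-l₂) 0)).toReal

/-- `F₁(x) = h((0,x])`: the cdf of the hiding distribution on the right arc. -/
def cdfRight (h : Measure ℝ) (x : ℝ) : ℝ := (h (Ioc 0 x)).toReal

/-- `F₂(y) = h([-y,0))`: the cdf of the hiding distribution on the left arc. -/
def cdfLeft (h : Measure ℝ) (y : ℝ) : ℝ := (h (Ico (-y) 0)).toReal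

/-- A hiding distribution on the two-arc star `Q = [-l₂, l₁]` is forward biased if
`F₁(x) ≤ (x + (h₁μ - λ₁)⁺)/(x + μ - λ₁)` for all `0 ≤ x ≤ λ₁` and
`F₂(y) ≤ (y + (h₂μ - λ₂)⁺)/(y + μ - λ₂)` for all `0 ≤ y ≤ λ₂`. -/
def ForwardBiased (l₁ l₂ : ℝ) (h : Measure ℝ) : Prop :=
  (∀ x : ℝ, 0 ≤ x → x ≤ l₁ →
    cdfRight h x ≤ (x + max (cdfRight h l₁ * (l₁ + l₂) - l₁) 0) / (x + (l₁ + l₂) - l₁)) ∧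
  (∀ y : ℝ, 0 ≤ y → y ≤ l₂ →
    cdfLeft h y ≤ (y + max (cdfLeft h l₂ * (l₁ + l₂) - l₂) 0) / (y + (l₁ + l₂) - l₂))

/-- Strictly forward biased: the forward-biased inequalities hold strictly at every
interior point of each arc. -/
def StrictlyForwardBiased (l₁ l₂ : ℝ) (h : Measure ℝ) : Prop :=
  ForwardBiased l₁ l₂ h ∧
  (∀ x : ℝ, 0 < x → x < l₁ →
    cdfRight h x < (x + max (cdfRight h l₁ * (l₁ + l₂) - l₁) 0) / (x + (l₁ + l₂) - l₁)) ∧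
  (∀ y : ℝ, 0 < y → y < l₂ →
    cdfLeft h y < (y + max (cdfLeft h l₂ * (l₁ + l₂) - l₂) 0) / (y + (l₁ + l₂) - l₂))

/-- The single-turn search `S*(x)`: unit speed from `0` to `x`, then to `-l₂`, then to
`l₁`, then rests. -/
def Sstar (l₁ l₂ x : ℝ) (t : ℝ) : ℝ :=
  if t ≤ x then t
  else if t ≤ 2 * x + l₂ then 2 * x - t
  else if t ≤ 2 * x + 2 * l₂ + l₁ then t - 2 * x - 2 * l₂
  else l₁

lemma searchTime_eq_ofReal {S : ℝ → ℝ} {y τ : ℝ} (hτ : 0 ≤ τ) (hS : S τ = y)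
    (hmin : ∀ t, 0 ≤ t → S t = y → τ ≤ t) : searchTime S y = ENNReal.ofReal τ := by
  refine le_antisymm (sInf_le ⟨τ, ⟨hτ, hS⟩, rfl⟩) (le_sInf ?_)
  rintro _ ⟨t, ⟨ht, hSt⟩, rfl⟩
  exact ENNReal.ofReal_le_ofReal (hmin t ht hSt)

lemma searchTime_Splus_of_pos {l₁ l₂ y : ℝ} (hy : 0 < y) (hyl : y ≤ l₁) :
    searchTime (Splus l₁ l₂) y = ENNReal.ofReal y := by
  refine searchTime_eq_ofReal hy.le (by simp [Splus, hyl]) fun t _ hSt => ?_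
  unfold Splus at hSt
  split_ifs at hSt <;> linarith

lemma searchTime_Splus_of_neg {l₁ l₂ y : ℝ} (hl₁ : 0 < l₁) (hy : y < 0) (hyl : -l₂ ≤ y) :
    searchTime (Splus l₁ l₂) y = ENNReal.ofReal (2 * l₁ - y) := by
  refine searchTime_eq_ofReal (by linarith) ?_ fun t _ hSt => ?_
  · unfold Splus
    split_ifs <;> linarith
  · unfold Splus at hSt
    split_ifs at hSt <;> linarith

lemma searchTime_Sstar_of_pos_of_le {l₁ l₂ x y : ℝ} (hl₂ : 0 < l₂) (hy : 0 < y) (hyx : y ≤ x) :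
    searchTime (Sstar l₁ l₂ x) y = ENNReal.ofReal y := by
  refine searchTime_eq_ofReal hy.le (by simp [Sstar, hyx]) fun t _ hSt => ?_
  unfold Sstar at hSt
  split_ifs at hSt <;> linarith

lemma searchTime_Sstar_of_neg {l₁ l₂ x y : ℝ} (hx : 0 < x) (hy : y < 0)
    (hyl : -l₂ ≤ y) : searchTime (Sstar l₁ l₂ x) y = ENNReal.ofReal (2 * x - y) := by
  refine searchTime_eq_ofReal (by linarith) ?_ fun t _ hSt => ?_
  · unfold Sstar
    split_ifs <;> linarith
  · unfold Sstar at hSt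
    split_ifs at hSt <;> linarith

lemma searchTime_Sstar_of_gt {l₁ l₂ x y : ℝ} (hl₂ : 0 < l₂) (hx : 0 < x) (hxy : x < y)
    (hyl : y ≤ l₁) :
    searchTime (Sstar l₁ l₂ x) y = ENNReal.ofReal (2 * x + 2 * l₂ + y) := by
  refine searchTime_eq_ofReal (by linarith) ?_ fun t _ hSt => ?_
  · unfold Sstar
    split_ifs <;> linarith
  · unfold Sstar at hSt
    split_ifs at hSt <;> linarith

/-- Away from the root, `S*(x)` gains `2 (l₁ - x)` over `S⁺` on the left arc and loses
`2 (x + l₂)` on `(x, l₁]`. -/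
lemma searchTime_Sstar_add {l₁ l₂ x y : ℝ} (hl₂ : 0 < l₂) (hx0 : 0 < x)
    (hx1 : x < l₁) (hy : y ∈ Icc (-l₂) l₁) (hy0 : y ≠ 0) :
    searchTime (Sstar l₁ l₂ x) y +
        (Ico (-l₂) 0).indicator (fun _ => ENNReal.ofReal (2 * (l₁ - x))) y =
      searchTime (Splus l₁ l₂) y +
        (Ioc x l₁).indicator (fun _ => ENNReal.ofReal (2 * (x + l₂))) y := by
  obtain ⟨hy1, hy2⟩ := hy
  rcases lt_or_gt_of_ne hy0 with hneg | hpos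
  · rw [searchTime_Sstar_of_neg hx0 hneg hy1,
      searchTime_Splus_of_neg (hx0.trans hx1) hneg hy1,
      indicator_of_mem (mem_Ico.2 ⟨hy1, hneg⟩), indicator_of_notMem (by simp; intro; linarith),
      ← ENNReal.ofReal_add (by linarith) (by linarith), add_zero]
    ring_nf
  · rw [searchTime_Splus_of_pos hpos hy2, indicator_of_notMem (by simp [hpos.le])]
    rcases le_or_gt y x with hyx | hyx
    · rw [searchTime_Sstar_of_pos_of_le hl₂ hpos hyx,
        indicator_of_notMem (by simp [hyx])]
    · rw [searchTime_Sstar_of_gt hl₂ hx0 hyx hy2, indicator_of_mem (mem_Ioc.2 ⟨hyx, hy2⟩),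
        ← ENNReal.ofReal_add (by linarith) (by linarith), add_zero]
      ring_nf

lemma searchTime_Splus_le {l₁ l₂ y : ℝ} (hl₁ : 0 < l₁) (hl₂ : 0 < l₂)
    (hy : y ∈ Icc (-l₂) l₁) (hy0 : y ≠ 0) :
    searchTime (Splus l₁ l₂) y ≤ ENNReal.ofReal (2 * l₁ + l₂) := by
  obtain ⟨hy1, hy2⟩ := hy
  rcases lt_or_gt_of_ne hy0 with hneg | hpos
  · rw [searchTime_Splus_of_neg hl₁ hneg hy1]
    exact ENNReal.ofReal_le_ofReal (by linarith)
  · rw [searchTime_Splus_of_pos hpos hy2]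
    exact ENNReal.ofReal_le_ofReal (by linarith)

lemma measureReal_left_arc {l₁ l₂ : ℝ} (hl₁ : 0 < l₁) (hl₂ : 0 < l₂)
    {h : Measure ℝ} [IsProbabilityMeasure h] (hsupp : h (Icc (-l₂) l₁) = 1)
    (hroot : h {0} = 0) : h.real (Ico (-l₂) 0) = 1 - cdfRight h l₁ := by
  have hIcc : h.real (Icc (-l₂) 0) = h.real (Ico (-l₂) 0) := by
    rw [← Ico_union_right (by linarith), measureReal_union (by simp) (by simp)]
    simp [Measure.real, hroot]
  have hsum : h.real (Icc (-l₂) l₁) = h.real (Icc (-l₂) 0) + h.real (Ioc 0 l₁) := by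
    rw [← Icc_union_Ioc_eq_Icc (by linarith : -l₂ ≤ 0) hl₁.le,
      measureReal_union _ measurableSet_Ioc]
    exact Set.disjoint_left.2 fun y hy hy' => not_lt.2 hy.2 hy'.1
  have hone : h.real (Icc (-l₂) l₁) = 1 := by simp [Measure.real, hsupp]
  change _ = 1 - h.real (Ioc 0 l₁)
  linarith

lemma measureReal_Ioc_eq_cdfRight_sub {l₁ x : ℝ} (hx0 : 0 ≤ x) (hx1 : x ≤ l₁)
    {h : Measure ℝ} [IsFiniteMeasure h] :
    h.real (Ioc x l₁) = cdfRight h l₁ - cdfRight h x := by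
  have hsum : h.real (Ioc 0 l₁) = h.real (Ioc 0 x) + h.real (Ioc x l₁) := by
    rw [← Ioc_union_Ioc_eq_Ioc hx0 hx1, measureReal_union _ measurableSet_Ioc]
    exact Set.disjoint_left.2 fun y hy hy' => not_lt.2 hy.2 hy'.1
  change _ = h.real (Ioc 0 l₁) - h.real (Ioc 0 x)
  linarith

/-- `T(S*(x),h) < T(S⁺,h)` if and only if `F₁(x) > (x + h₁μ - λ₁)/(x + λ₂)`. -/
theorem Sstar_beats_Splus_iff (l₁ l₂ : ℝ) (hl₁ : 0 < l₁) (hl₂ : 0 < l₂)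
    (h : Measure ℝ) [IsProbabilityMeasure h] (hsupp : h (Icc (-l₂) l₁) = 1)
    (hroot : h {0} = 0) (x : ℝ) (hx0 : 0 < x) (hx1 : x < l₁) :
    expTime (Sstar l₁ l₂ x) h < expTime (Splus l₁ l₂) h ↔
      (x + cdfRight h l₁ * (l₁ + l₂) - l₁) / (x + l₂) < cdfRight h x := by
  have hae : ∀ᵐ y ∂h, y ∈ Icc (-l₂) l₁ ∧ y ≠ 0 := by
    refine Filter.Eventually.and ((prob_compl_eq_zero_iff measurableSet_Icc).2 hsupp) ?_
    rw [ae_iff]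
    simpa using hroot
  have hplus : expTime (Splus l₁ l₂) h ≠ ∞ := by
    refine ne_top_of_le_ne_top (ENNReal.ofReal_ne_top (r := 2 * l₁ + l₂))
      ((lintegral_mono_ae (hae.mono fun y hy => searchTime_Splus_le hl₁ hl₂ hy.1 hy.2)).trans ?_)
    simp
  have key : expTime (Sstar l₁ l₂ x) h +
        ENNReal.ofReal (2 * (l₁ - x)) * h (Ico (-l₂) 0) =
      expTime (Splus l₁ l₂) h + ENNReal.ofReal (2 * (x + l₂)) * h (Ioc x l₁) := by
    have hint := lintegral_congr_ae
      (hae.mono fun y hy => searchTime_Sstar_add hl₂ hx0 hx1 hy.1 hy.2)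
    rwa [lintegral_add_right _ (measurable_const.indicator measurableSet_Ico),
      lintegral_add_right _ (measurable_const.indicator measurableSet_Ioc),
      lintegral_indicator_const measurableSet_Ico,
      lintegral_indicator_const measurableSet_Ioc] at hint
  have hgain : ENNReal.ofReal (2 * (l₁ - x)) * h (Ico (-l₂) 0) ≠ ∞ :=
    ENNReal.mul_ne_top ENNReal.ofReal_ne_top (measure_ne_top _ _)
  have hloss : ENNReal.ofReal (2 * (x + l₂)) * h (Ioc x l₁) ≠ ∞ :=
    ENNReal.mul_ne_top ENNReal.ofReal_ne_top (measure_ne_top _ _)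
  have hstar : expTime (Sstar l₁ l₂ x) h ≠ ∞ :=
    ne_top_of_le_ne_top (ENNReal.add_ne_top.2 ⟨hplus, hloss⟩) (key ▸ le_self_add)
  have hreal := congrArg ENNReal.toReal key
  rw [ENNReal.toReal_add hstar hgain, ENNReal.toReal_add hplus hloss, ENNReal.toReal_mul,
    ENNReal.toReal_mul, ENNReal.toReal_ofReal (by linarith),
    ENNReal.toReal_ofReal (by linarith), ← Measure.real, ← Measure.real,
    measureReal_left_arc hl₁ hl₂ hsupp hroot,
    measureReal_Ioc_eq_cdfRight_sub hx0.le hx1.le] at hreal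
  rw [← ENNReal.toReal_lt_toReal hstar hplus, div_lt_iff₀ (by linarith)]
  constructor <;> intro _ <;> nlinarith

end
end

section
/- Suppose the hiding distribution h on Q satisfies h({0}) = 0, is balanced, and is forward biased. Then h is leafy at both leaf nodes; more precisely, liminf_{ε→0⁺} h([λ₁−ε, λ₁])/ε ≥ λ₂/μ² > 0 and liminf_{ε→0⁺} h([−λ₂, −λ₂+ε])/ε ≥ λ₁/μ² > 0. -/
open MeasureTheory Set Filter
open scoped ENNReal

noncomputable section

/-- A linear lower bound near `0⁺` bounds the lower right density from below. -/
theorem ofReal_le_liminf_div_ofReal {φ : ℝ → ℝ≥0∞} {c δ : ℝ} (hc : 0 < c) (hδ : 0 < δ)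
    (hφ : ∀ ε, 0 < ε → ε < δ → ENNReal.ofReal (c * ε) ≤ φ ε) :
    ENNReal.ofReal c ≤ liminf (fun ε : ℝ => φ ε / ENNReal.ofReal ε) (nhdsWithin 0 (Ioi 0)) ∧
      0 < liminf (fun ε : ℝ => φ ε / ENNReal.ofReal ε) (nhdsWithin 0 (Ioi 0)) := by
  have key : ENNReal.ofReal c ≤
      liminf (fun ε : ℝ => φ ε / ENNReal.ofReal ε) (nhdsWithin 0 (Ioi 0)) := by
    refine le_liminf_of_le (by isBoundedDefault) ?_
    filter_upwards [Ioo_mem_nhdsGT hδ] with ε hε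
    rw [ENNReal.le_div_iff_mul_le (Or.inl (ENNReal.ofReal_pos.2 hε.1).ne')
      (Or.inl ENNReal.ofReal_ne_top), ← ENNReal.ofReal_mul hc.le]
    exact hφ ε hε.1 hε.2
  exact ⟨key, (ENNReal.ofReal_pos.2 hc).trans_le key⟩

/-- The gap left near the far end of an arc of length `a` and mass `a / (a + b)` by the
forward-biased upper bound on the distribution function. -/
theorem mul_le_sub_of_forward_bound {a b m F ε : ℝ} (ha : 0 < a) (hb : 0 < b)
    (hm : m = a / (a + b)) (hε : 0 < ε) (hεa : ε < a)
    (hF : F ≤ ((a - ε) + max (m * (a + b) - a) 0) / ((a - ε) + (a + b) - a)) :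
    b / (a + b) ^ 2 * ε ≤ m - F := by
  have hs : 0 < a + b := by linarith
  have hd : 0 < a + b - ε := by linarith
  have hmul : m * (a + b) - a = 0 := by rw [hm]; field_simp; ring
  rw [hmul, max_self, add_zero, show (a - ε) + (a + b) - a = a + b - ε by ring] at hF
  have hgap : a / (a + b) - (a - ε) / (a + b - ε) = b * ε / ((a + b) * (a + b - ε)) := by
    field_simp
    ring
  have hle : b / (a + b) ^ 2 * ε ≤ b * ε / ((a + b) * (a + b - ε)) := by
    rw [div_mul_eq_mul_div]
    apply div_le_div_of_nonneg_left (by positivity) (by positivity)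
    nlinarith
  linarith

/-- If `s ⊆ t ∪ u`, then `h u` is at least the difference of the masses of `s` and `t`. -/
theorem ofReal_le_measure_of_subset_union {α : Type*} [MeasurableSpace α] {h : Measure α}
    [IsFiniteMeasure h] {s t u : Set α} {r : ℝ} (hsub : s ⊆ t ∪ u)
    (hr : r ≤ (h s).toReal - (h t).toReal) : ENNReal.ofReal r ≤ h u := by
  have hle : h.real s ≤ h.real t + h.real u :=
    (measureReal_mono hsub).trans (measureReal_union_le t u)
  simp only [Measure.real] at hle
  exact ENNReal.ofReal_le_of_le_toReal (by linarith)

/-- The two open arcs carry all the mass when the root is not an atom. -/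
theorem cdfRight_add_cdfLeft {l₁ l₂ : ℝ} (hl₁ : 0 < l₁) (hl₂ : 0 < l₂)
    {h : Measure ℝ} (hsupp : h (Icc (-l₂) l₁) = 1) (hroot : h {0} = 0) :
    cdfRight h l₁ + cdfLeft h l₂ = 1 := by
  have hsplit : h (Icc (-l₂) l₁) = h (Ioc 0 l₁) + h (Ico (-l₂) 0) := by
    have hset : Icc (-l₂) l₁ = Ico (-l₂) 0 ∪ Icc 0 l₁ :=
      (Ico_union_Icc_eq_Icc (by linarith) hl₁.le).symm
    have hdisj : Disjoint (Ico (-l₂) 0) (Icc 0 l₁) :=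
      disjoint_left.2 fun x hx hx' => absurd hx.2 (not_lt.2 hx'.1)
    have hnull : h (Icc 0 l₁) = h (Ioc 0 l₁) := by
      rw [← Icc_sdiff_left, measure_sdiff_null hroot]
    rw [hset, measure_union hdisj measurableSet_Icc, hnull, add_comm]
  rw [hsupp] at hsplit
  have h1 : h (Ioc 0 l₁) ≠ ⊤ := fun e => by simp [e] at hsplit
  have h2 : h (Ico (-l₂) 0) ≠ ⊤ := fun e => by simp [e] at hsplit
  rw [cdfRight, cdfLeft, ← ENNReal.toReal_add h1 h2, ← hsplit, ENNReal.toReal_one]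

/-- A balanced, forward biased hiding distribution (with no atom at the root) is leafy at
both leaf nodes, with liminf density at least `λ₂/μ²` at `λ₁` and `λ₁/μ²` at `-λ₂`. -/
theorem balanced_forward_biased_leafy (l₁ l₂ : ℝ) (hl₁ : 0 < l₁) (hl₂ : 0 < l₂)
    (h : Measure ℝ) [IsProbabilityMeasure h] (hsupp : h (Icc (-l₂) l₁) = 1)
    (hroot : h {0} = 0) (hbal : BalancedDist l₁ l₂ h) (hfb : ForwardBiased l₁ l₂ h) :
    (ENNReal.ofReal (l₂ / (l₁ + l₂) ^ 2) ≤ Filter.liminf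
        (fun ε : ℝ => h (Icc (l₁ - ε) l₁) / ENNReal.ofReal ε) (nhdsWithin 0 (Ioi 0)) ∧
      0 < Filter.liminf
        (fun ε : ℝ => h (Icc (l₁ - ε) l₁) / ENNReal.ofReal ε) (nhdsWithin 0 (Ioi 0))) ∧
    (ENNReal.ofReal (l₁ / (l₁ + l₂) ^ 2) ≤ Filter.liminf
        (fun ε : ℝ => h (Icc (-l₂) (-l₂ + ε)) / ENNReal.ofReal ε)
        (nhdsWithin 0 (Ioi 0)) ∧
      0 < Filter.liminf
        (fun ε : ℝ => h (Icc (-l₂) (-l₂ + ε)) / ENNReal.ofReal ε)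
        (nhdsWithin 0 (Ioi 0))) := by
  have hsum := cdfRight_add_cdfLeft hl₁ hl₂ hsupp hroot
  have hbal' : l₂ * cdfRight h l₁ = l₁ * cdfLeft h l₂ := hbal
  have hs : 0 < l₁ + l₂ := by linarith
  have hm₁ : cdfRight h l₁ = l₁ / (l₁ + l₂) := by
    rw [eq_div_iff hs.ne']
    linear_combination hbal' + l₁ * hsum
  have hm₂ : cdfLeft h l₂ = l₂ / (l₂ + l₁) := by
    rw [eq_div_iff (by linarith)]
    linear_combination l₂ * hsum - hbal'
  constructor
  · refine ofReal_le_liminf_div_ofReal (by positivity) hl₁ fun ε hε hεl => ?_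
    refine ofReal_le_measure_of_subset_union (s := Ioc 0 l₁) (t := Ioc 0 (l₁ - ε)) ?_
      (mul_le_sub_of_forward_bound hl₁ hl₂ hm₁ hε hεl
        (hfb.1 (l₁ - ε) (by linarith) (by linarith)))
    intro x hx
    rcases le_total x (l₁ - ε) with hle | hle
    · exact Or.inl ⟨hx.1, hle⟩
    · exact Or.inr ⟨hle, hx.2⟩
  · refine ofReal_le_liminf_div_ofReal (by positivity) hl₂ fun ε hε hεl => ?_
    have hF := hfb.2 (l₂ - ε) (by linarith) (by linarith)
    rw [add_comm l₁ l₂] at hF ⊢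
    refine ofReal_le_measure_of_subset_union (s := Ico (-l₂) 0) (t := Ico (-(l₂ - ε)) 0) ?_
      (mul_le_sub_of_forward_bound hl₂ hl₁ hm₂ hε hεl hF)
    intro x hx
    rcases le_total (-(l₂ - ε)) x with hle | hle
    · exact Or.inl ⟨hle, hx.2⟩
    · exact Or.inr ⟨hx.1, by linarith⟩

end
end
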